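/- Let σ : ℝ → ℝ be polynomially bounded with noise sensitivity exponent β⋆ < ∞, and for λ > 0 define J(λ) := E_Y[(E[z² − 1 | Y])²], where z ∼ N(0,1) and Y ∼ N(√λ σ(z), 1). Then lim_{λ→0⁺} λ^{−β⋆} J(λ) = μ_{β⋆}² / β⋆!, where μ_β := E_{z∼N(0,1)}[σ(z)^β (z² − 1)]. -/

import Mathlib

open MeasureTheory ProbabilityTheory Filter

/-- Standard Gaussian measure on ℝ. -/
noncomputable def stdG : Measure ℝ := gaussianReal 0 1

/-- Standard Gaussian density on ℝ. -/
noncomputable def gphi (x : ℝ) : ℝ := Real.exp (-(x ^ 2) / 2) / Real.sqrt (2 * Real.pi)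

/-- σ is polynomially bounded. -/
def PolyBounded (σ : ℝ → ℝ) : Prop :=
  ∃ (C : ℝ) (k : ℕ), 0 < C ∧ 0 < k ∧ ∀ x : ℝ, |σ x| ≤ C * (1 + |x| ^ k)

open Polynomial in
/-- The probabilists' Hermite polynomials with real coefficients. -/
noncomputable def hermiteReal : ℕ → ℝ[X]
  | 0 => 1
  | n + 1 => X * hermiteReal n - derivative (hermiteReal n)

/-- The likelihood ratio of `N(a, 1)` against `N(0, 1)`. -/
noncomputable def tilt (y a : ℝ) : ℝ := Real.exp (y * a - a ^ 2 / 2)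

instance : IsProbabilityMeasure stdG := by unfold stdG; infer_instance

lemma gphi_pos (x : ℝ) : 0 < gphi x := by unfold gphi; positivity

lemma tilt_pos (y a : ℝ) : 0 < tilt y a := Real.exp_pos _

lemma tilt_le (y a : ℝ) : tilt y a ≤ Real.exp (y ^ 2 / 2) :=
  Real.exp_le_exp.2 (by nlinarith [sq_nonneg (y - a)])

lemma gphi_sub (y a : ℝ) : gphi (y - a) = gphi y * tilt y a := by
  unfold gphi tilt
  rw [div_mul_eq_mul_div, ← Real.exp_add]
  congr 2
  ring

lemma gphi_eq_gaussianPDFReal : gphi = gaussianPDFReal 0 1 := by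
  ext x
  simp [gphi, gaussianPDFReal, div_eq_inv_mul, mul_comm]

lemma integral_stdG (f : ℝ → ℝ) : ∫ y, f y ∂stdG = ∫ y, gphi y * f y := by
  rw [stdG, integral_gaussianReal_eq_integral_smul one_ne_zero, gphi_eq_gaussianPDFReal]
  rfl

lemma integrable_stdG_iff (f : ℝ → ℝ) :
    Integrable f stdG ↔ Integrable (fun y => gphi y * f y) volume := by
  rw [stdG, gaussianReal_of_var_ne_zero _ one_ne_zero,
    integrable_withDensity_iff_integrable_smul' (measurable_gaussianPDF 0 1)
      (ae_of_all _ fun _ => gaussianPDF_lt_top), gphi_eq_gaussianPDFReal]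
  simp [toReal_gaussianPDF]

lemma integrable_exp_abs (c : ℝ) : Integrable (fun y => Real.exp (c * |y|)) stdG := by
  simpa using integrable_exp_mul_abs (X := id) (μ := stdG) (t := c)
    (integrable_exp_mul_gaussianReal _) (integrable_exp_mul_gaussianReal _)

lemma integral_tilt (a : ℝ) : ∫ y, tilt y a ∂stdG = 1 := by
  have h := congrFun (mgf_id_gaussianReal (μ := 0) (v := 1)) a
  simp only [mgf, id] at h
  simp only [tilt, sub_eq_add_neg, Real.exp_add, integral_mul_const, stdG]
  simp_rw [mul_comm _ a, h, ← Real.exp_add]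
  simp

lemma integrable_tilt (a : ℝ) : Integrable (fun y => tilt y a) stdG := by
  have h := (integrable_exp_mul_gaussianReal (μ := 0) (v := 1) a).mul_const (Real.exp (-(a ^ 2 / 2)))
  simpa only [stdG, tilt, sub_eq_add_neg, Real.exp_add, mul_comm _ a] using h

lemma polynomial_eval_le_exp (p : Polynomial ℝ) :
    ∃ C : ℝ, 0 < C ∧ ∀ x : ℝ, |p.eval x| ≤ C * Real.exp |x| := by
  induction p using Polynomial.induction_on' with
  | add p q hp hq =>
    obtain ⟨C, hC, hp⟩ := hp
    obtain ⟨D, hD, hq⟩ := hq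
    refine ⟨C + D, by positivity, fun x => ?_⟩
    rw [Polynomial.eval_add, add_mul]
    exact (abs_add_le _ _).trans (add_le_add (hp x) (hq x))
  | monomial n a =>
    refine ⟨(|a| + 1) * n.factorial, by positivity, fun x => ?_⟩
    rw [Polynomial.eval_monomial, abs_mul, abs_pow, mul_assoc]
    have h := Real.pow_div_factorial_le_exp |x| (abs_nonneg x) n
    rw [div_le_iff₀' (by positivity)] at h
    gcongr
    linarith

lemma integrable_polynomial_eval (p : Polynomial ℝ) : Integrable (fun x => p.eval x) stdG := by
  obtain ⟨C, -, h⟩ := polynomial_eval_le_exp p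
  refine ((integrable_exp_abs 1).const_mul C).mono' (by fun_prop) (ae_of_all _ fun x => ?_)
  simpa using h x

lemma hasDerivAt_gphi (x : ℝ) : HasDerivAt gphi (-(x * gphi x)) x := by
  have h : HasDerivAt (fun x : ℝ => -(x ^ 2) / 2) (-x) x := by
    have := ((hasDerivAt_id x).pow 2).neg.div_const 2
    convert! this using 1
    simp only [id]
    ring
  convert! h.exp.div_const (Real.sqrt (2 * Real.pi)) using 1
  simp only [gphi]
  ring

open Polynomial in
/-- Gaussian integration by parts. -/
lemma integral_X_mul_sub_derivative (p : ℝ[X]) :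
    ∫ x, (X * p - derivative p).eval x ∂stdG = 0 := by
  rw [integral_stdG]
  refine integral_eq_zero_of_hasDerivAt_of_integrable (f := fun x => -(gphi x * p.eval x))
    (fun x => ?_) ((integrable_stdG_iff _).1 (integrable_polynomial_eval _))
    ((integrable_stdG_iff _).1 (integrable_polynomial_eval _)).neg
  convert! ((hasDerivAt_gphi x).mul (p.hasDerivAt x)).neg using 1
  simp only [eval_sub, eval_mul, eval_X]
  ring

open Polynomial in
lemma derivative_hermiteReal_succ (n : ℕ) :
    derivative (hermiteReal (n + 1)) = (n + 1 : ℝ[X]) * hermiteReal n := by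
  induction n with
  | zero => simp [hermiteReal]
  | succ n ih =>
    have h : hermiteReal (n + 1) = X * hermiteReal n - derivative (hermiteReal n) := rfl
    rw [hermiteReal, derivative_sub, derivative_mul, derivative_X, ih, derivative_mul]
    have h2 : derivative ((n : ℝ[X]) + 1) = 0 := by simp
    rw [h2]
    push_cast
    rw [h]
    ring

open Polynomial in
lemma integral_hermiteReal_sq (n : ℕ) :
    ∫ x, (hermiteReal n).eval x ^ 2 ∂stdG = n.factorial := by
  induction n with
  | zero => simp [hermiteReal]
  | succ n ih =>
    have h := integral_X_mul_sub_derivative (hermiteReal (n + 1) * hermiteReal n)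
    have e : ∀ x, (X * (hermiteReal (n + 1) * hermiteReal n)
        - derivative (hermiteReal (n + 1) * hermiteReal n)).eval x
        = (hermiteReal (n + 1) ^ 2).eval x - (n + 1) * (hermiteReal n ^ 2).eval x := by
      intro x
      rw [derivative_mul, derivative_hermiteReal_succ]
      have hr : (hermiteReal (n + 1)).eval x
          = x * (hermiteReal n).eval x - (derivative (hermiteReal n)).eval x := by
        simp [hermiteReal]
      simp only [eval_sub, eval_mul, eval_add, eval_pow, eval_X, eval_natCast, eval_one]
      linear_combination -(hermiteReal (n + 1)).eval x * hr
    simp_rw [e] at h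
    rw [integral_sub (integrable_polynomial_eval _) ((integrable_polynomial_eval _).const_mul _),
      integral_const_mul] at h
    simp only [eval_pow, ih] at h
    rw [Nat.factorial_succ]
    push_cast
    linarith

lemma taylor_bound_of_hasDerivAt {M : ℝ} (n : ℕ) (F : ℕ → ℝ → ℝ)
    (hF : ∀ k x, HasDerivAt (F k) (F (k + 1) x) x) (hM : ∀ x, |x| ≤ 1 → |F n x| ≤ M)
    {a : ℝ} (ha : |a| ≤ 1) :
    |F 0 a - ∑ k ∈ Finset.range n, F k 0 * a ^ k / k.factorial| ≤ M * |a| ^ n := by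
  induction n generalizing F a with
  | zero => simpa using hM a ha
  | succ n ih =>
    have hd : ∀ x, HasDerivAt
        (fun a => F 0 a - ∑ k ∈ Finset.range (n + 1), F k 0 * a ^ k / k.factorial)
        (F 1 x - ∑ k ∈ Finset.range n, F (k + 1) 0 * x ^ k / k.factorial) x := by
      intro x
      refine (hF 0 x).sub ?_
      simp_rw [Finset.sum_range_succ' _ n]
      simp only [pow_zero, mul_one]
      refine HasDerivAt.add_const _ ?_
      refine HasDerivAt.fun_sum fun k _ => ?_
      convert! ((hasDerivAt_pow (k + 1) x).const_mul (F (k + 1) 0)).div_const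
        ((k + 1).factorial : ℝ) using 1
      rw [Nat.factorial_succ]
      push_cast
      field_simp
    have hM0 : 0 ≤ M := (abs_nonneg _).trans (hM 0 (by simp))
    have hb := Convex.norm_image_sub_le_of_norm_hasDerivWithin_le (s := Metric.closedBall 0 |a|)
      (C := M * |a| ^ n) (x := 0) (y := a) (fun x _ => (hd x).hasDerivWithinAt) (fun x hx => by
        have hx : |x| ≤ |a| := by simpa using hx
        refine (ih (fun k => F (k + 1)) (fun k => hF (k + 1)) hM (hx.trans ha)).trans ?_
        gcongr) (convex_closedBall _ _) (by simp) (by simp)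
    simpa [Finset.sum_range_succ', pow_succ, mul_assoc] using hb

open Polynomial in
lemma hasDerivAt_hermiteReal_mul_tilt (y : ℝ) (n : ℕ) (a : ℝ) :
    HasDerivAt (fun a => (hermiteReal n).eval (y - a) * tilt y a)
      ((hermiteReal (n + 1)).eval (y - a) * tilt y a) a := by
  have h1 : HasDerivAt (fun a => (hermiteReal n).eval (y - a))
      (-(derivative (hermiteReal n)).eval (y - a)) a := by
    convert! ((hermiteReal n).hasDerivAt (y - a)).comp a ((hasDerivAt_id a).const_sub y) using 1
    simp
  have h2 : HasDerivAt (fun a => tilt y a) (tilt y a * (y - a)) a := by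
    refine HasDerivAt.exp ?_
    convert! ((hasDerivAt_id a).const_mul y).sub (((hasDerivAt_id a).pow 2).div_const 2) using 1
    simp
  convert! h1.mul h2 using 1
  simp only [hermiteReal, eval_sub, eval_mul, eval_X]
  ring

lemma abs_tilt_sub_le (n : ℕ) : ∃ C : ℝ, 0 < C ∧ ∀ y a : ℝ, |a| ≤ 1 →
    |tilt y a - ∑ k ∈ Finset.range n, (hermiteReal k).eval y * a ^ k / k.factorial|
      ≤ C * Real.exp (2 * |y|) * |a| ^ n := by
  obtain ⟨C, hC, h⟩ := polynomial_eval_le_exp (hermiteReal n)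
  refine ⟨C * Real.exp 1, by positivity, fun y a ha => ?_⟩
  have key := taylor_bound_of_hasDerivAt (M := C * Real.exp 1 * Real.exp (2 * |y|)) n
    (fun k a => (hermiteReal k).eval (y - a) * tilt y a)
    (fun k x => hasDerivAt_hermiteReal_mul_tilt y k x) (fun x hx => ?_) ha
  · simpa [hermiteReal, tilt] using key
  · rw [abs_mul, abs_of_pos (tilt_pos y x)]
    have h1 : |y - x| ≤ |y| + 1 := (abs_sub y x).trans (by linarith)
    have h2 : y * x ≤ |y| :=
      (le_abs_self _).trans ((abs_mul y x).trans_le (mul_le_of_le_one_right (abs_nonneg y) hx))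
    calc _ ≤ (C * Real.exp |y - x|) * Real.exp |y| := by
          refine mul_le_mul (h _) ?_ (tilt_pos y x).le (by positivity)
          exact Real.exp_le_exp.2 (by nlinarith [sq_nonneg x])
      _ ≤ (C * Real.exp (|y| + 1)) * Real.exp |y| := by gcongr
      _ = _ := by rw [Real.exp_add, two_mul, Real.exp_add]; ring

lemma measurable_tilt_comp {u : ℝ → ℝ} (hu : Measurable u) :
    Measurable (fun p : ℝ × ℝ => tilt p.1 (u p.2)) := by
  unfold tilt
  fun_prop

lemma measurable_tilt_right {u : ℝ → ℝ} (hu : Measurable u) (y : ℝ) :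
    Measurable (fun z => tilt y (u z)) := by
  unfold tilt
  fun_prop

lemma stronglyMeasurable_integral_tilt {u f : ℝ → ℝ} (hu : Measurable u) (hf : Measurable f) :
    StronglyMeasurable (fun y => ∫ z, f z * tilt y (u z) ∂stdG) := by
  refine StronglyMeasurable.integral_prod_right (f := fun y z => f z * tilt y (u z)) ?_
  exact ((hf.comp measurable_snd).mul (measurable_tilt_comp hu)).stronglyMeasurable

lemma integrable_mul_tilt {u f : ℝ → ℝ} (hu : Measurable u) (hf : Integrable f stdG) (y : ℝ) :
    Integrable (fun z => f z * tilt y (u z)) stdG := by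
  refine hf.mul_bdd (c := Real.exp (y ^ 2 / 2)) (measurable_tilt_right hu y).aestronglyMeasurable
    (ae_of_all _ fun z => ?_)
  rw [Real.norm_eq_abs, abs_of_pos (tilt_pos _ _)]
  exact tilt_le _ _

lemma integrable_tilt_right {u : ℝ → ℝ} (hu : Measurable u) (y : ℝ) :
    Integrable (fun z => tilt y (u z)) stdG := by
  simpa using integrable_mul_tilt hu (integrable_const (1 : ℝ)) y

lemma exp_integral_le_integral_tilt {u : ℝ → ℝ} (hu : Measurable u)
    (h1 : Integrable u stdG) (h2 : Integrable (fun z => u z ^ 2) stdG) (y : ℝ) :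
    Real.exp (y * ∫ z, u z ∂stdG - (∫ z, u z ^ 2 ∂stdG) / 2) ≤ ∫ z, tilt y (u z) ∂stdG := by
  set c := y * ∫ z, u z ∂stdG - (∫ z, u z ^ 2 ∂stdG) / 2 with hc
  have hX : Integrable (fun z => y * u z - u z ^ 2 / 2) stdG :=
    (h1.const_mul y).sub (h2.div_const 2)
  have hXc : ∫ z, (y * u z - u z ^ 2 / 2) ∂stdG = c := by
    rw [integral_sub (h1.const_mul y) (h2.div_const 2), integral_const_mul, integral_div]
  have h : ∫ z, Real.exp c * ((1 - c) + (y * u z - u z ^ 2 / 2)) ∂stdG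
      ≤ ∫ z, tilt y (u z) ∂stdG := by
    refine integral_mono (((integrable_const _).add hX).const_mul _) (integrable_tilt_right hu y)
      fun z => ?_
    have e : tilt y (u z) = Real.exp c * Real.exp (y * u z - u z ^ 2 / 2 - c) := by
      rw [← Real.exp_add, tilt]
      ring_nf
    have := Real.add_one_le_exp (y * u z - u z ^ 2 / 2 - c)
    simp only [e]
    gcongr
    linarith
  rw [integral_const_mul, integral_add (integrable_const _) hX, hXc] at h
  simpa using h

lemma integral_tilt_pos {u : ℝ → ℝ} (hu : Measurable u) (y : ℝ) :
    0 < ∫ z, tilt y (u z) ∂stdG :=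
  integral_exp_pos (integrable_tilt_right hu y)

lemma sq_integral_tilt_div_le {u f : ℝ → ℝ} (hu : Measurable u)
    (hf : Integrable f stdG) (hf2 : Integrable (fun z => f z ^ 2) stdG) (y : ℝ) :
    (∫ z, f z * tilt y (u z) ∂stdG) ^ 2 / (∫ z, tilt y (u z) ∂stdG)
      ≤ ∫ z, f z ^ 2 * tilt y (u z) ∂stdG := by
  have hpos := integral_tilt_pos hu y
  set Z := ∫ z, tilt y (u z) ∂stdG
  set N := ∫ z, f z * tilt y (u z) ∂stdG
  have i1 := integrable_mul_tilt hu hf y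
  have i2 := integrable_mul_tilt hu hf2 y
  have h : 0 ≤ ∫ z, (f z ^ 2 * tilt y (u z) - 2 * (N / Z) * (f z * tilt y (u z))
      + (N / Z) ^ 2 * tilt y (u z)) ∂stdG := by
    refine integral_nonneg fun z => ?_
    have : 0 ≤ (f z - N / Z) ^ 2 * tilt y (u z) := mul_nonneg (sq_nonneg _) (tilt_pos _ _).le
    simp only [Pi.zero_apply]
    linarith
  have i3 : Integrable (fun z => f z ^ 2 * tilt y (u z) - 2 * (N / Z) * (f z * tilt y (u z))) stdG :=
    i2.sub (i1.const_mul _)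
  rw [integral_add i3 ((integrable_tilt_right hu y).const_mul _),
    integral_sub i2 (i1.const_mul _), integral_const_mul, integral_const_mul] at h
  have e : N ^ 2 / Z = 2 * (N / Z) * N - (N / Z) ^ 2 * Z := by
    field_simp
    ring
  linarith

lemma integrable_prod_sq_mul_tilt {u f : ℝ → ℝ} (hu : Measurable u) (hf : Measurable f)
    (hf2 : Integrable (fun z => f z ^ 2) stdG) :
    Integrable (fun p : ℝ × ℝ => f p.2 ^ 2 * tilt p.1 (u p.2)) (stdG.prod stdG) := by
  have hm : Measurable (fun p : ℝ × ℝ => f p.2 ^ 2 * tilt p.1 (u p.2)) :=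
    ((hf.comp measurable_snd).pow_const 2).mul (measurable_tilt_comp hu)
  rw [integrable_prod_iff' hm.aestronglyMeasurable]
  refine ⟨ae_of_all _ fun z => (integrable_tilt (u z)).const_mul (f z ^ 2), ?_⟩
  convert! hf2 using 2 with z
  simp only [norm_mul, Real.norm_eq_abs, abs_of_pos (tilt_pos _ _), integral_const_mul,
    integral_tilt, mul_one, abs_sq]

lemma integrable_sq_integral_tilt_div {u f : ℝ → ℝ} (hu : Measurable u) (hf : Measurable f)
    (hf1 : Integrable f stdG) (hf2 : Integrable (fun z => f z ^ 2) stdG) :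
    Integrable (fun y => (∫ z, f z * tilt y (u z) ∂stdG) ^ 2 / (∫ z, tilt y (u z) ∂stdG)) stdG := by
  refine (integrable_prod_sq_mul_tilt hu hf hf2).integral_prod_left.mono' ?_
    (ae_of_all _ fun y => ?_)
  · have h := stronglyMeasurable_integral_tilt hu (measurable_const (a := (1 : ℝ)))
    simp only [one_mul] at h
    exact (((stronglyMeasurable_integral_tilt hu hf).measurable.pow_const 2).div
      h.measurable).aestronglyMeasurable
  · rw [Real.norm_eq_abs, abs_of_nonneg (div_nonneg (sq_nonneg _) (integral_tilt_pos hu y).le)]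
    exact sq_integral_tilt_div_le hu hf1 hf2 y

/-- Conditioning contracts second moments. -/
lemma integral_sq_integral_tilt_div_le {u f : ℝ → ℝ} (hu : Measurable u) (hf : Measurable f)
    (hf1 : Integrable f stdG) (hf2 : Integrable (fun z => f z ^ 2) stdG) :
    ∫ y, (∫ z, f z * tilt y (u z) ∂stdG) ^ 2 / (∫ z, tilt y (u z) ∂stdG) ∂stdG
      ≤ ∫ z, f z ^ 2 ∂stdG := by
  have hi := integrable_prod_sq_mul_tilt hu hf hf2
  calc _ ≤ ∫ y, ∫ z, f z ^ 2 * tilt y (u z) ∂stdG ∂stdG :=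
        integral_mono (integrable_sq_integral_tilt_div hu hf hf1 hf2) hi.integral_prod_left
          fun y => sq_integral_tilt_div_le hu hf1 hf2 y
    _ = _ := by
        rw [integral_integral_swap hi]
        simp only [integral_const_mul, integral_tilt, mul_one]

/-- Remainder of the Hermite expansion of the likelihood ratio truncated to `|a| ≤ 1`. -/
noncomputable def truncRem (n : ℕ) (y a : ℝ) : ℝ :=
  (if |a| ≤ 1 then tilt y a else 0)
    - ∑ k ∈ Finset.range n, (hermiteReal k).eval y * a ^ k / k.factorial

lemma abs_truncRem_le (n : ℕ) : ∃ C : ℝ, 0 < C ∧ ∀ y a : ℝ,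
    |truncRem n y a| ≤ C * Real.exp (2 * |y|) * |a| ^ n := by
  obtain ⟨C, hC, h⟩ := abs_tilt_sub_le n
  choose D hD hD' using fun k => polynomial_eval_le_exp (hermiteReal k)
  have hS : 0 ≤ ∑ k ∈ Finset.range n, D k := Finset.sum_nonneg fun k _ => (hD k).le
  refine ⟨C + ∑ k ∈ Finset.range n, D k, by positivity, fun y a => ?_⟩
  unfold truncRem
  split_ifs with ha
  · refine (h y a ha).trans ?_
    gcongr
    linarith
  · push Not at ha
    rw [zero_sub, abs_neg]
    calc _ ≤ ∑ k ∈ Finset.range n, D k * Real.exp (2 * |y|) * |a| ^ n := by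
          refine (Finset.abs_sum_le_sum_abs _ _).trans (Finset.sum_le_sum fun k hk => ?_)
          rw [abs_div, abs_mul, abs_pow, Nat.abs_cast]
          have h1 : (1 : ℝ) ≤ k.factorial := by exact_mod_cast k.factorial_pos
          refine (div_le_self (by positivity) h1).trans ?_
          have h2 : |a| ^ k ≤ |a| ^ n := pow_le_pow_right₀ ha.le (Finset.mem_range.1 hk).le
          have h3 : Real.exp |y| ≤ Real.exp (2 * |y|) :=
            Real.exp_le_exp.2 (by linarith [abs_nonneg y])
          have h4 : |(hermiteReal k).eval y| ≤ D k * Real.exp (2 * |y|) :=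
            (hD' k y).trans (mul_le_mul_of_nonneg_left h3 (hD k).le)
          exact mul_le_mul h4 h2 (by positivity) (mul_nonneg (hD k).le (Real.exp_pos _).le)
      _ = (∑ k ∈ Finset.range n, D k) * Real.exp (2 * |y|) * |a| ^ n := by
          rw [Finset.sum_mul, Finset.sum_mul]
      _ ≤ _ := by
          gcongr
          linarith

lemma truncRem_succ (n : ℕ) (y a : ℝ) :
    truncRem (n + 1) y a = truncRem n y a - (hermiteReal n).eval y * a ^ n / n.factorial := by
  rw [truncRem, truncRem, Finset.sum_range_succ]
  ring

lemma tendsto_truncRem (n : ℕ) (y c : ℝ) :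
    Tendsto (fun s : ℝ => truncRem n y (s * c) / s ^ n) (nhdsWithin 0 (Set.Ioi 0))
      (nhds ((hermiteReal n).eval y * c ^ n / n.factorial)) := by
  obtain ⟨C, hC, h⟩ := abs_truncRem_le (n + 1)
  rw [tendsto_iff_norm_sub_tendsto_zero]
  have h0 : Tendsto (fun s : ℝ => C * Real.exp (2 * |y|) * |c| ^ (n + 1) * s)
      (nhdsWithin 0 (Set.Ioi 0)) (nhds 0) := by
    have : Continuous (fun s : ℝ => C * Real.exp (2 * |y|) * |c| ^ (n + 1) * s) := by fun_prop
    simpa using (this.tendsto 0).mono_left nhdsWithin_le_nhds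
  refine squeeze_zero' (Eventually.of_forall fun _ => norm_nonneg _) ?_ h0
  filter_upwards [self_mem_nhdsWithin] with s hs
  have hs : 0 < s := hs
  have e : truncRem n y (s * c) / s ^ n - (hermiteReal n).eval y * c ^ n / n.factorial
      = truncRem (n + 1) y (s * c) / s ^ n := by
    rw [truncRem_succ, mul_pow]
    field_simp
  rw [e, Real.norm_eq_abs, abs_div, abs_of_pos (pow_pos hs n), div_le_iff₀ (pow_pos hs n)]
  refine (h y (s * c)).trans_eq ?_
  rw [abs_mul, abs_of_pos hs, mul_pow]
  ring

lemma PolyBounded.integrable_moment {σ : ℝ → ℝ} (hmeas : Measurable σ) (hpb : PolyBounded σ)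
    (m n : ℕ) : Integrable (fun z => |σ z| ^ m * |z ^ 2 - 1| ^ n) stdG := by
  obtain ⟨C, k, hC, -, h⟩ := hpb
  obtain ⟨D, hD, hD'⟩ := polynomial_eval_le_exp (Polynomial.X ^ 2 - 1)
  obtain ⟨E, hE, hE'⟩ := polynomial_eval_le_exp (Polynomial.X ^ k)
  simp only [Polynomial.eval_sub, Polynomial.eval_pow, Polynomial.eval_X, Polynomial.eval_one,
    abs_pow] at hD' hE'
  have hσ : ∀ z, |σ z| ≤ (C * (1 + E)) * Real.exp |z| := fun z => by
    refine (h z).trans ?_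
    rw [mul_assoc]
    gcongr
    linarith [hE' z, Real.one_le_exp (abs_nonneg z)]
  refine ((integrable_exp_abs (m + n)).const_mul ((C * (1 + E)) ^ m * D ^ n)).mono' (by fun_prop)
    (ae_of_all _ fun z => ?_)
  rw [Real.norm_eq_abs, abs_of_nonneg (by positivity)]
  calc _ ≤ ((C * (1 + E)) * Real.exp |z|) ^ m * (D * Real.exp |z|) ^ n := by
        gcongr
        · exact hσ z
        · exact hD' z
    _ = _ := by
        rw [mul_pow, mul_pow, add_mul, Real.exp_add, Real.exp_nat_mul, Real.exp_nat_mul]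
        ring

/-- The second Hermite polynomial restricted to the region where the signal `s * σ` is small. -/
noncomputable def truncWeight (σ : ℝ → ℝ) (s z : ℝ) : ℝ :=
  if |s * σ z| ≤ 1 then z ^ 2 - 1 else 0

lemma measurable_truncWeight {σ : ℝ → ℝ} (hmeas : Measurable σ) (s : ℝ) :
    Measurable (truncWeight σ s) := by
  unfold truncWeight
  refine Measurable.ite (measurableSet_le (by fun_prop) (by fun_prop)) (by fun_prop) (by fun_prop)

lemma measurable_truncRem (n : ℕ) (y : ℝ) : Measurable (truncRem n y) := by
  unfold truncRem tilt
  refine Measurable.sub (Measurable.ite (measurableSet_le (by fun_prop) (by fun_prop))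
    (by fun_prop) (by fun_prop)) (by fun_prop)

section Moments

variable {σ : ℝ → ℝ}

lemma integrable_weight : Integrable (fun z : ℝ => z ^ 2 - 1) stdG := by
  convert! integrable_polynomial_eval (Polynomial.X ^ 2 - 1) using 2 with z
  simp

lemma integrable_weight_sq : Integrable (fun z : ℝ => (z ^ 2 - 1) ^ 2) stdG := by
  convert! integrable_polynomial_eval ((Polynomial.X ^ 2 - 1) ^ 2) using 2 with z
  simp

lemma integral_weight : ∫ z : ℝ, (z ^ 2 - 1) ∂stdG = 0 := by
  simpa [pow_two] using integral_X_mul_sub_derivative Polynomial.X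

lemma abs_truncWeight_le (s z : ℝ) : |truncWeight σ s z| ≤ |z ^ 2 - 1| := by
  unfold truncWeight
  split_ifs <;> simp

lemma integrable_truncWeight (hmeas : Measurable σ) (s : ℝ) :
    Integrable (truncWeight σ s) stdG :=
  integrable_weight.mono (measurable_truncWeight hmeas s).aestronglyMeasurable
    (ae_of_all _ (abs_truncWeight_le s))

lemma integrable_truncWeight_sq (hmeas : Measurable σ) (s : ℝ) :
    Integrable (fun z => truncWeight σ s z ^ 2) stdG :=
  integrable_weight_sq.mono ((measurable_truncWeight hmeas s).pow_const 2).aestronglyMeasurable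
    (ae_of_all _ fun z => by
      simpa only [norm_pow, Real.norm_eq_abs] using pow_le_pow_left₀ (abs_nonneg _) (abs_truncWeight_le s z) 2)

lemma sq_tail_le (s z : ℝ) (n : ℕ) :
    (z ^ 2 - 1 - truncWeight σ s z) ^ 2 ≤ |s| ^ n * (|σ z| ^ n * |z ^ 2 - 1| ^ 2) := by
  unfold truncWeight
  split_ifs with h
  · rw [sub_self, zero_pow two_ne_zero]
    positivity
  · push Not at h
    rw [sub_zero, sq_abs, ← mul_assoc, ← mul_pow, ← abs_mul]
    exact le_mul_of_one_le_left (sq_nonneg _) (one_le_pow₀ h.le)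

lemma tendsto_integral_tilt (hmeas : Measurable σ) (y : ℝ) :
    Tendsto (fun s : ℝ => ∫ z, tilt y (s * σ z) ∂stdG) (nhdsWithin 0 (Set.Ioi 0)) (nhds 1) := by
  have h : Tendsto (fun s : ℝ => ∫ z, tilt y (s * σ z) ∂stdG) (nhdsWithin 0 (Set.Ioi 0))
      (nhds (∫ _, (1 : ℝ) ∂stdG)) := by
    refine tendsto_integral_filter_of_dominated_convergence (fun _ => Real.exp (y ^ 2 / 2))
      (Eventually.of_forall fun s =>
        (measurable_tilt_right (hmeas.const_mul s) y).aestronglyMeasurable)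
      (Eventually.of_forall fun s => ae_of_all _ fun z => ?_) (integrable_const _)
      (ae_of_all _ fun z => ?_)
    · rw [Real.norm_eq_abs, abs_of_pos (tilt_pos _ _)]
      exact tilt_le _ _
    · have hc : Continuous (fun s : ℝ => tilt y (s * σ z)) := by
        unfold tilt
        fun_prop
      simpa [tilt] using (hc.tendsto 0).mono_left nhdsWithin_le_nhds
  simpa using h

lemma integrable_pow_mul_weight (hmeas : Measurable σ)
    (hI : ∀ m n : ℕ, Integrable (fun z => |σ z| ^ m * |z ^ 2 - 1| ^ n) stdG) (k : ℕ) :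
    Integrable (fun z => σ z ^ k * (z ^ 2 - 1)) stdG :=
  (hI k 1).mono' (by fun_prop) (ae_of_all _ fun z => by simp)

lemma integral_truncWeight_mul_tilt (hmeas : Measurable σ)
    (hI : ∀ m n : ℕ, Integrable (fun z => |σ z| ^ m * |z ^ 2 - 1| ^ n) stdG) {n : ℕ}
    (h0 : ∀ k < n, ∫ z, σ z ^ k * (z ^ 2 - 1) ∂stdG = 0) (s y : ℝ) :
    ∫ z, truncWeight σ s z * tilt y (s * σ z) ∂stdG
      = ∫ z, (z ^ 2 - 1) * truncRem n y (s * σ z) ∂stdG := by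
  have i1 := integrable_mul_tilt (hmeas.const_mul s) (integrable_truncWeight hmeas s) y
  have i2 : ∀ k, Integrable (fun z => (hermiteReal k).eval y * s ^ k / k.factorial
      * (σ z ^ k * (z ^ 2 - 1))) stdG := fun k =>
    (integrable_pow_mul_weight hmeas hI k).const_mul _
  have e : ∀ z, (z ^ 2 - 1) * truncRem n y (s * σ z)
      = truncWeight σ s z * tilt y (s * σ z) - ∑ k ∈ Finset.range n,
        (hermiteReal k).eval y * s ^ k / k.factorial * (σ z ^ k * (z ^ 2 - 1)) := by
    intro z
    rw [truncRem, truncWeight, mul_sub, Finset.mul_sum]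
    congr 1
    · split_ifs <;> simp
    · refine Finset.sum_congr rfl fun k _ => ?_
      rw [mul_pow]
      ring
  simp_rw [e]
  rw [integral_sub i1 (integrable_finsetSum _ fun k _ => i2 k),
    integral_finsetSum _ fun k _ => i2 k, Finset.sum_eq_zero, sub_zero]
  intro k hk
  rw [integral_const_mul, h0 k (Finset.mem_range.1 hk), mul_zero]

lemma exists_inv_integral_tilt_le (hmeas : Measurable σ)
    (hI : ∀ m n : ℕ, Integrable (fun z => |σ z| ^ m * |z ^ 2 - 1| ^ n) stdG) :
    ∃ K : ℝ, 0 < K ∧ ∀ s y : ℝ, 0 < s → s ≤ 1 →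
    (∫ z, tilt y (s * σ z) ∂stdG)⁻¹ ≤ Real.exp K * Real.exp (K * |y|) := by
  have h1 : Integrable (fun z => |σ z|) stdG := by simpa using hI 1 0
  have h1' : Integrable σ stdG := h1.mono' (by fun_prop) (ae_of_all _ fun z => le_rfl)
  have h2 : Integrable (fun z => σ z ^ 2) stdG := by simpa using hI 2 0
  set K := 1 + |∫ z, σ z ∂stdG| + ∫ z, σ z ^ 2 ∂stdG with hK
  have p2 : 0 ≤ ∫ z, σ z ^ 2 ∂stdG := integral_nonneg fun z => sq_nonneg _
  refine ⟨K, by positivity, fun s y hs hs1 => ?_⟩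
  have h := exp_integral_le_integral_tilt (hmeas.const_mul s) (h1'.const_mul s)
    (by simpa only [mul_pow] using h2.const_mul (s ^ 2)) y
  simp only [mul_pow, integral_const_mul] at h
  rw [← Real.exp_add]
  refine inv_le_of_inv_le₀ (Real.exp_pos _) ?_
  rw [← Real.exp_neg]
  refine (Real.exp_le_exp.2 ?_).trans h
  have a1 : |y * (s * ∫ z, σ z ∂stdG)| ≤ K * |y| := by
    rw [abs_mul, abs_mul, abs_of_pos hs, mul_comm]
    gcongr
    have := mul_le_of_le_one_left (abs_nonneg (∫ z, σ z ∂stdG)) hs1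
    linarith
  have a2 : s ^ 2 * ∫ z, σ z ^ 2 ∂stdG ≤ K := by
    have := mul_le_of_le_one_left p2 (pow_le_one₀ hs.le hs1 : s ^ 2 ≤ 1)
    linarith [abs_nonneg (∫ z, σ z ∂stdG)]
  have a3 : 0 ≤ s ^ 2 * ∫ z, σ z ^ 2 ∂stdG := by positivity
  linarith [neg_abs_le (y * (s * ∫ z, σ z ∂stdG))]

lemma tendsto_integral_truncWeight (hmeas : Measurable σ)
    (hI : ∀ m n : ℕ, Integrable (fun z => |σ z| ^ m * |z ^ 2 - 1| ^ n) stdG) {n : ℕ}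
    (h0 : ∀ k < n, ∫ z, σ z ^ k * (z ^ 2 - 1) ∂stdG = 0) (y : ℝ) :
    Tendsto (fun s : ℝ => (∫ z, truncWeight σ s z * tilt y (s * σ z) ∂stdG) / s ^ n)
      (nhdsWithin 0 (Set.Ioi 0))
      (nhds ((hermiteReal n).eval y / n.factorial * ∫ z, σ z ^ n * (z ^ 2 - 1) ∂stdG)) := by
  obtain ⟨C, hC, hb⟩ := abs_truncRem_le n
  simp_rw [integral_truncWeight_mul_tilt hmeas hI h0]
  simp_rw [← integral_div, ← integral_const_mul]
  refine tendsto_integral_filter_of_dominated_convergence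
    (fun z => C * Real.exp (2 * |y|) * (|σ z| ^ n * |z ^ 2 - 1| ^ 1))
    (Eventually.of_forall fun s => ?_) ?_ ((hI n 1).const_mul _) (ae_of_all _ fun z => ?_)
  · have := (measurable_truncRem n y).comp (hmeas.const_mul s)
    exact ((Measurable.mul (by fun_prop) this).div_const _).aestronglyMeasurable
  · filter_upwards [self_mem_nhdsWithin] with s hs
    have hs : 0 < s := hs
    refine ae_of_all _ fun z => ?_
    rw [Real.norm_eq_abs, abs_div, abs_of_pos (pow_pos hs n), div_le_iff₀ (pow_pos hs n), abs_mul]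
    refine (mul_le_mul_of_nonneg_left (hb y (s * σ z)) (abs_nonneg _)).trans_eq ?_
    rw [abs_mul, abs_of_pos hs]
    ring
  · convert! (tendsto_truncRem n y (σ z)).const_mul (z ^ 2 - 1) using 2
    · ring
    · ring

lemma tendsto_integral_sq_truncWeight (hmeas : Measurable σ)
    (hI : ∀ m n : ℕ, Integrable (fun z => |σ z| ^ m * |z ^ 2 - 1| ^ n) stdG) {n : ℕ}
    (h0 : ∀ k < n, ∫ z, σ z ^ k * (z ^ 2 - 1) ∂stdG = 0) :
    Tendsto (fun s : ℝ => ∫ y, ((∫ z, truncWeight σ s z * tilt y (s * σ z) ∂stdG) / s ^ n) ^ 2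
        / (∫ z, tilt y (s * σ z) ∂stdG) ∂stdG)
      (nhdsWithin 0 (Set.Ioi 0))
      (nhds ((∫ z, σ z ^ n * (z ^ 2 - 1) ∂stdG) ^ 2 / n.factorial)) := by
  obtain ⟨C, hC, hb⟩ := abs_truncRem_le n
  obtain ⟨K, hK, hζ⟩ := exists_inv_integral_tilt_le hmeas hI
  set μ := ∫ z, σ z ^ n * (z ^ 2 - 1) ∂stdG with hμ
  set m := ∫ z, |σ z| ^ n * |z ^ 2 - 1| ^ 1 ∂stdG with hm
  have e : μ ^ 2 / n.factorial
      = ∫ y, ((hermiteReal n).eval y / n.factorial * μ) ^ 2 / 1 ∂stdG := by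
    have e1 : ∀ y, ((hermiteReal n).eval y / n.factorial * μ) ^ 2 / 1
        = μ ^ 2 / (n.factorial : ℝ) ^ 2 * (hermiteReal n).eval y ^ 2 := fun y => by ring
    simp_rw [e1]
    rw [integral_const_mul, integral_hermiteReal_sq]
    field_simp
  rw [e]
  refine tendsto_integral_filter_of_dominated_convergence
    (fun y => (C * m) ^ 2 * Real.exp K * Real.exp ((4 + K) * |y|))
    (Eventually.of_forall fun s => ?_) ?_ ((integrable_exp_abs _).const_mul _)
    (ae_of_all _ fun y => ?_)
  · have h := stronglyMeasurable_integral_tilt (hmeas.const_mul s) (measurable_const (a := (1 : ℝ)))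
    simp only [one_mul] at h
    exact ((((stronglyMeasurable_integral_tilt (hmeas.const_mul s)
      (measurable_truncWeight hmeas s)).measurable.div_const _).pow_const 2).div
      h.measurable).aestronglyMeasurable
  · filter_upwards [Ioc_mem_nhdsGT one_pos] with s hs
    refine ae_of_all _ fun y => ?_
    have hsn : 0 < s ^ n := pow_pos hs.1 n
    have hA : |(∫ z, truncWeight σ s z * tilt y (s * σ z) ∂stdG) / s ^ n|
        ≤ C * Real.exp (2 * |y|) * m := by
      rw [abs_div, abs_of_pos hsn, div_le_iff₀ hsn, integral_truncWeight_mul_tilt hmeas hI h0,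
        hm, ← integral_const_mul, ← integral_mul_const, ← Real.norm_eq_abs]
      refine norm_integral_le_of_norm_le (((hI n 1).const_mul _).mul_const _)
        (ae_of_all _ fun z => ?_)
      rw [norm_mul, Real.norm_eq_abs, Real.norm_eq_abs]
      refine (mul_le_mul_of_nonneg_left (hb y (s * σ z)) (abs_nonneg _)).trans_eq ?_
      rw [abs_mul, abs_of_pos hs.1]
      ring
    rw [div_eq_mul_inv, norm_mul, norm_pow, norm_inv, Real.norm_eq_abs, Real.norm_eq_abs,
      abs_of_pos (integral_tilt_pos (hmeas.const_mul s) y)]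
    calc _ ≤ (C * Real.exp (2 * |y|) * m) ^ 2 * (Real.exp K * Real.exp (K * |y|)) := by
          have hp := inv_nonneg.2 (integral_tilt_pos (hmeas.const_mul s) y).le
          exact mul_le_mul (pow_le_pow_left₀ (abs_nonneg _) hA 2) (hζ s y hs.1 hs.2) hp
            (by positivity)
      _ = _ := by
          rw [show (4 + K) * |y| = 2 * |y| + 2 * |y| + K * |y| by ring, Real.exp_add, Real.exp_add]
          ring
  · exact ((tendsto_integral_truncWeight hmeas hI h0 y).pow 2).div
      (tendsto_integral_tilt hmeas y) one_ne_zero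

lemma abs_integral_sq_sub_le (hmeas : Measurable σ)
    (hI : ∀ m n : ℕ, Integrable (fun z => |σ z| ^ m * |z ^ 2 - 1| ^ n) stdG) {s : ℝ} (hs : 0 < s) (n : ℕ) :
    |∫ y, (∫ z, (z ^ 2 - 1) * tilt y (s * σ z) ∂stdG) ^ 2 / (∫ z, tilt y (s * σ z) ∂stdG) ∂stdG
      - ∫ y, (∫ z, truncWeight σ s z * tilt y (s * σ z) ∂stdG) ^ 2
        / (∫ z, tilt y (s * σ z) ∂stdG) ∂stdG|
    ≤ s * (∫ y, (∫ z, truncWeight σ s z * tilt y (s * σ z) ∂stdG) ^ 2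
        / (∫ z, tilt y (s * σ z) ∂stdG) ∂stdG)
      + (1 + s⁻¹) * (s ^ n * ∫ z, |σ z| ^ n * |z ^ 2 - 1| ^ 2 ∂stdG) := by
  have hu := hmeas.const_mul s
  have hw := measurable_truncWeight hmeas s
  have hw1 := integrable_truncWeight hmeas s
  have ht : Measurable (fun z => z ^ 2 - 1 - truncWeight σ s z) := Measurable.sub (by fun_prop) hw
  have ht1 : Integrable (fun z => z ^ 2 - 1 - truncWeight σ s z) stdG := integrable_weight.sub hw1
  have htb : ∀ z, (z ^ 2 - 1 - truncWeight σ s z) ^ 2 ≤ s ^ n * (|σ z| ^ n * |z ^ 2 - 1| ^ 2) :=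
    fun z => by simpa [abs_of_pos hs] using sq_tail_le (σ := σ) s z n
  have ht2 : Integrable (fun z => (z ^ 2 - 1 - truncWeight σ s z) ^ 2) stdG :=
    ((hI n 2).const_mul (s ^ n)).mono' (ht.pow_const 2).aestronglyMeasurable
      (ae_of_all _ fun z => by
        rw [Real.norm_eq_abs, abs_of_nonneg (sq_nonneg _)]
        exact htb z)
  have iN := integrable_sq_integral_tilt_div hu (by fun_prop) integrable_weight
    integrable_weight_sq
  have iA := integrable_sq_integral_tilt_div hu hw hw1 (integrable_truncWeight_sq hmeas s)
  have iB := integrable_sq_integral_tilt_div hu ht ht1 ht2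
  have hB := (integral_sq_integral_tilt_div_le hu ht ht1 ht2).trans
    (integral_mono ht2 ((hI n 2).const_mul (s ^ n)) htb)
  rw [integral_const_mul] at hB
  have hs' : 0 < 1 + s⁻¹ := by positivity
  refine le_trans ?_ (add_le_add_right (mul_le_mul_of_nonneg_left hB hs'.le) _)
  rw [← integral_sub iN iA, ← integral_const_mul, ← integral_const_mul,
    ← integral_add (iA.const_mul _) (iB.const_mul _), ← Real.norm_eq_abs]
  refine norm_integral_le_of_norm_le ((iA.const_mul _).add (iB.const_mul _))
    (ae_of_all _ fun y => ?_)
  have hZ := integral_tilt_pos hu y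
  have hN : ∫ z, (z ^ 2 - 1) * tilt y (s * σ z) ∂stdG
      = (∫ z, truncWeight σ s z * tilt y (s * σ z) ∂stdG)
        + ∫ z, (z ^ 2 - 1 - truncWeight σ s z) * tilt y (s * σ z) ∂stdG := by
    rw [← integral_add (integrable_mul_tilt hu hw1 y) (integrable_mul_tilt hu ht1 y)]
    congr 1
    ext z
    ring
  rw [hN]
  set A := ∫ z, truncWeight σ s z * tilt y (s * σ z) ∂stdG
  set B := ∫ z, (z ^ 2 - 1 - truncWeight σ s z) * tilt y (s * σ z) ∂stdG
  set Z := ∫ z, tilt y (s * σ z) ∂stdG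
  have key : |(A + B) ^ 2 - A ^ 2| ≤ s * A ^ 2 + (1 + s⁻¹) * B ^ 2 := by
    have h1 : s * A ^ 2 + s⁻¹ * B ^ 2 - 2 * A * B = s⁻¹ * (s * A - B) ^ 2 := by
      field_simp
      ring
    have h2 : s * A ^ 2 + s⁻¹ * B ^ 2 + 2 * A * B = s⁻¹ * (s * A + B) ^ 2 := by
      field_simp
      ring
    have h3 : 0 ≤ s⁻¹ * (s * A - B) ^ 2 := by positivity
    have h4 : 0 ≤ s⁻¹ * (s * A + B) ^ 2 := by positivity
    rw [abs_le]
    constructor <;> nlinarith [sq_nonneg B]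
  rw [Real.norm_eq_abs, ← sub_div, abs_div, abs_of_pos hZ, mul_div_assoc', mul_div_assoc',
    ← add_div]
  exact div_le_div_of_nonneg_right key hZ.le

lemma tendsto_integral_sq_weight (hmeas : Measurable σ)
    (hI : ∀ m n : ℕ, Integrable (fun z => |σ z| ^ m * |z ^ 2 - 1| ^ n) stdG) {n : ℕ}
    (h0 : ∀ k < n, ∫ z, σ z ^ k * (z ^ 2 - 1) ∂stdG = 0) :
    Tendsto (fun s : ℝ => (∫ y, (∫ z, (z ^ 2 - 1) * tilt y (s * σ z) ∂stdG) ^ 2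
        / (∫ z, tilt y (s * σ z) ∂stdG) ∂stdG) / (s ^ n) ^ 2)
      (nhdsWithin 0 (Set.Ioi 0))
      (nhds ((∫ z, σ z ^ n * (z ^ 2 - 1) ∂stdG) ^ 2 / (n.factorial : ℝ))) := by
  have hA := tendsto_integral_sq_truncWeight hmeas hI h0
  set M := ∫ z, |σ z| ^ (2 * n + 2) * |z ^ 2 - 1| ^ 2 ∂stdG
  have hid : Tendsto (fun s : ℝ => s) (nhdsWithin 0 (Set.Ioi 0)) (nhds 0) :=
    tendsto_id.mono_left nhdsWithin_le_nhds
  have hbound := (hid.mul hA).add (((hid.pow 2).add hid).mul_const M)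
  simp only [zero_mul, ne_eq, OfNat.ofNat_ne_zero, not_false_eq_true, zero_pow, add_zero]
    at hbound
  refine tendsto_of_tendsto_of_dist hA (squeeze_zero' (Eventually.of_forall fun _ => dist_nonneg)
    ?_ hbound)
  filter_upwards [self_mem_nhdsWithin] with s hs
  have hs : 0 < s := hs
  have h := abs_integral_sq_sub_le hmeas hI hs (2 * n + 2)
  have hsn : 0 < (s ^ n) ^ 2 := by positivity
  simp_rw [div_pow, div_right_comm _ ((s ^ n) ^ 2), integral_div]
  rw [dist_comm, Real.dist_eq, ← sub_div, abs_div, abs_of_pos hsn, div_le_iff₀ hsn]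
  refine h.trans_eq ?_
  field_simp
  ring

end Moments

lemma integral_gphi_eq (σ : ℝ → ℝ) (s : ℝ) :
    ∫ y, (∫ z, (z ^ 2 - 1) * gphi (y - s * σ z) ∂stdG) ^ 2 / (∫ z, gphi (y - s * σ z) ∂stdG)
      = ∫ y, (∫ z, (z ^ 2 - 1) * tilt y (s * σ z) ∂stdG) ^ 2
        / (∫ z, tilt y (s * σ z) ∂stdG) ∂stdG := by
  rw [integral_stdG]
  congr 1
  ext y
  have hg := (gphi_pos y).ne'
  simp_rw [gphi_sub, mul_left_comm _ (gphi y), integral_const_mul]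
  rw [mul_pow, pow_two (gphi y), mul_assoc, mul_div_mul_left _ _ hg, mul_div_assoc]

/-- For σ with noise sensitivity exponent `β⋆ < ∞` and `Y ∼ N(√λ σ(z), 1)`,
with `J(λ) = E_Y[(E[z² − 1 | Y])²]` (written as `∫ N(y)²/Z(y) dy` where
`N(y) = E_z[(z²−1) φ(y−√λσ(z))]`, `Z(y) = E_z[φ(y−√λσ(z))]`), one has
`lim_{λ→0⁺} λ^{−β⋆} J(λ) = μ_{β⋆}² / β⋆!`, where `μ_β = E[σ(z)^β (z²−1)]`. -/
theorem stmt9 (σ : ℝ → ℝ) (hmeas : Measurable σ) (hpb : PolyBounded σ)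
    (β : ℕ) (hβ : 1 ≤ β)
    (hzero : ∀ b : ℕ, 1 ≤ b → b < β → ∫ z, σ z ^ b * (z ^ 2 - 1) ∂stdG = 0)
    (hnz : ∫ z, σ z ^ β * (z ^ 2 - 1) ∂stdG ≠ 0) :
    Tendsto
      (fun lam : ℝ =>
        (∫ y : ℝ,
          (∫ z, (z ^ 2 - 1) * gphi (y - Real.sqrt lam * σ z) ∂stdG) ^ 2 /
            (∫ z, gphi (y - Real.sqrt lam * σ z) ∂stdG)) / lam ^ β)
      (nhdsWithin 0 (Set.Ioi 0))
      (nhds ((∫ z, σ z ^ β * (z ^ 2 - 1) ∂stdG) ^ 2 / Nat.factorial β)) := by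
  have hI := hpb.integrable_moment hmeas
  have h0 : ∀ k < β, ∫ z, σ z ^ k * (z ^ 2 - 1) ∂stdG = 0 := fun k hk => by
    rcases Nat.eq_zero_or_pos k with rfl | h
    · simpa using integral_weight
    · exact hzero k h hk
  have hsqrt : Tendsto Real.sqrt (nhdsWithin 0 (Set.Ioi 0)) (nhdsWithin 0 (Set.Ioi 0)) := by
    refine tendsto_nhdsWithin_iff.2 ⟨?_, ?_⟩
    · simpa using (Real.continuous_sqrt.tendsto 0).mono_left nhdsWithin_le_nhds
    · filter_upwards [self_mem_nhdsWithin] with x hx using Real.sqrt_pos.2 hx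
  refine ((tendsto_integral_sq_weight hmeas hI h0).comp hsqrt).congr' ?_
  filter_upwards [self_mem_nhdsWithin] with x hx
  have hx : 0 < x := hx
  rw [Function.comp_apply, integral_gphi_eq, ← pow_mul, mul_comm β, pow_mul, Real.sq_sqrt hx.le]
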